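/- arXiv:1303.7430 — 5 statements merged into one kernel-verified Lean document; each statement's English description precedes it below -/
import Mathlib

section
/- Let I be the minimal Herbrand model of Ξ(K). For all terms w1', w1, w2', w2, all roles R, S, T, and every A among the atomic concepts and ⊤: if R(w1',f_{T,A}(w1))∈I, S(w2',f_{T,A}(w2))∈I, f_{T,A}(w1)≈f_{T,A}(w2)∈I, and f_{T,A}(w2)∈aux(I), then w1'≈w2'∈I. -/
namespace ELHO

variable {C R V Ind : Type}

/-- Unary predicates: atomic concepts, ⊤ and ⊥. -/
inductive UPred (C : Type) where
  | conc : C → UPred C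
  | top : UPred C
  | bot : UPred C

/-- Concepts that are either atomic (`some A`) or ⊤ (`none`). -/
abbrev CT (C : Type) := Option C

/-- View a concept-or-⊤ as a unary predicate. -/
def ctU : CT C → UPred C
  | some A => .conc A
  | none => .top

def UPred.clist : UPred C → List C
  | .conc A => [A]
  | _ => []

/-- Normalised ELHO TBox axioms (Table 1). -/
inductive Ax (C R Ind : Type) where
  | nom : Ind → CT C → Ax C R Ind              -- {a} ⊑ A
  | sub : CT C → UPred C → Ax C R Ind          -- A ⊑ B
  | subNom : CT C → Ind → Ax C R Ind           -- A ⊑ {a}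
  | conj : CT C → CT C → CT C → Ax C R Ind     -- A1 ⊓ A2 ⊑ A
  | exSub : R → CT C → CT C → Ax C R Ind       -- ∃R.A1 ⊑ A
  | subEx : CT C → R → CT C → Ax C R Ind       -- A1 ⊑ ∃R.A
  | roleSub : R → R → Ax C R Ind               -- R ⊑ S
  | range : R → CT C → Ax C R Ind              -- ran(R) ⊑ A

/-- Atomic concepts occurring in an axiom. -/
def Ax.concepts : Ax C R Ind → List C
  | .nom _ A => A.toList
  | .sub A B => A.toList ++ B.clist
  | .subNom A _ => A.toList
  | .conj A1 A2 A => A1.toList ++ A2.toList ++ A.toList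
  | .exSub _ A1 A => A1.toList ++ A.toList
  | .subEx A1 _ A => A1.toList ++ A.toList
  | .roleSub _ _ => []
  | .range _ A => A.toList

/-- Roles occurring in an axiom. -/
def Ax.roles : Ax C R Ind → List R
  | .nom _ _ => []
  | .sub _ _ => []
  | .subNom _ _ => []
  | .conj _ _ _ => []
  | .exSub S _ _ => [S]
  | .subEx _ S _ => [S]
  | .roleSub S S' => [S, S']
  | .range S _ => [S]

/-- ABox assertions: ground facts over individuals. -/
inductive AFact (C R Ind : Type) where
  | unary : UPred C → Ind → AFact C R Ind
  | role : R → Ind → Ind → AFact C R Ind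

/-- A normalised ELHO knowledge base K = ⟨T,A⟩. -/
structure KB (C R Ind : Type) where
  tbox : List (Ax C R Ind)
  abox : List (AFact C R Ind)

/-- Terms of the Herbrand universe of Ξ(K): individuals and terms built with
    the unary function symbols `f_{R,A}`. -/
inductive XTerm (C R Ind : Type) where
  | ind : Ind → XTerm C R Ind
  | fn : R → CT C → XTerm C R Ind → XTerm C R Ind

/-- Terms of the Herbrand universe of dat(K): individuals and the auxiliary
    individuals `o_{R,A}`. -/
inductive DTerm (C R Ind : Type) where
  | ind : Ind → DTerm C R Ind
  | aux : R → CT C → DTerm C R Ind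

/-- The mapping δ: δ(a) = a and δ(f_{R,A}(w')) = o_{R,A}. -/
def δ : XTerm C R Ind → DTerm C R Ind
  | .ind a => .ind a
  | .fn S A _ => .aux S A

/-- Ground facts over a term type `T`. -/
inductive Fact (C R T : Type) where
  | unary : UPred C → T → Fact C R T
  | role : R → T → T → Fact C R T
  | eq : T → T → Fact C R T

/-- `t` occurs in the fact (any predicate, including ≈). -/
def occursF {T : Type} (t : T) : Fact C R T → Prop
  | .unary _ s => s = t
  | .role _ s s' => s = t ∨ s' = t
  | .eq s s' => s = t ∨ s' = t

/-- `t` occurs in the fact and the fact is not an ≈-fact. -/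
def occursNE {T : Type} (t : T) : Fact C R T → Prop
  | .unary _ s => s = t
  | .role _ s s' => s = t ∨ s' = t
  | .eq _ _ => False

/-- N_I(H): terms occurring in the model `H` in at least one non-≈ fact. -/
def NI {T : Type} (H : Fact C R T → Prop) (t : T) : Prop := ∃ f, H f ∧ occursNE t f

/-- `t` occurs in the model `H` (in any fact). -/
def occursM {T : Type} (H : Fact C R T → Prop) (t : T) : Prop := ∃ f, H f ∧ occursF t f

/-- aux(H): 'true' auxiliary terms of a Herbrand model `H`, i.e. the terms of
    N_I(H) that are ≈-equal to no named individual (`ι` injects the named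
    individuals into the term type). -/
def auxT {T : Type} (H : Fact C R T → Prop) (ι : Ind → T) (t : T) : Prop :=
  NI H t ∧ ∀ a : Ind, ¬ H (.eq t (ι a))

/-- The minimal Herbrand model of Ξ(K) (with the equality axiomatisation),
    defined as the least set of ground facts closed under all clauses of
    Ξ(K) ∪ Ξ(K)_≈. -/
inductive XI (K : KB C R Ind) : Fact C R (XTerm C R Ind) → Prop where
  | abU {B a} : AFact.unary B a ∈ K.abox → XI K (.unary B (.ind a))
  | abR {S a b} : AFact.role S a b ∈ K.abox → XI K (.role S (.ind a) (.ind b))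
  | nom {a A} : Ax.nom a A ∈ K.tbox → XI K (.unary (ctU A) (.ind a))
  | sub {A B w} : Ax.sub A B ∈ K.tbox → XI K (.unary (ctU A) w) → XI K (.unary B w)
  | subNom {A a w} : Ax.subNom A a ∈ K.tbox → XI K (.unary (ctU A) w) →
      XI K (.eq w (.ind a))
  | conj {A1 A2 A w} : Ax.conj A1 A2 A ∈ K.tbox → XI K (.unary (ctU A1) w) →
      XI K (.unary (ctU A2) w) → XI K (.unary (ctU A) w)
  | exSub {S A1 A w w'} : Ax.exSub S A1 A ∈ K.tbox → XI K (.role S w w') →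
      XI K (.unary (ctU A1) w') → XI K (.unary (ctU A) w)
  | subEx1 {A1 S A w} : Ax.subEx A1 S A ∈ K.tbox → XI K (.unary (ctU A1) w) →
      XI K (.role S w (.fn S A w))
  | subEx2 {A1 S A w} : Ax.subEx A1 S A ∈ K.tbox → XI K (.unary (ctU A1) w) →
      XI K (.unary (ctU A) (.fn S A w))
  | roleSub {S S' w w'} : Ax.roleSub S S' ∈ K.tbox → XI K (.role S w w') →
      XI K (.role S' w w')
  | range {S A w w'} : Ax.range S A ∈ K.tbox → XI K (.role S w w') →
      XI K (.unary (ctU A) w')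
  | topU {A w} : A ∈ K.tbox.flatMap Ax.concepts → XI K (.unary (.conc A) w) →
      XI K (.unary .top w)
  | topR1 {S w w'} : S ∈ K.tbox.flatMap Ax.roles → XI K (.role S w w') →
      XI K (.unary .top w)
  | topR2 {S w w'} : S ∈ K.tbox.flatMap Ax.roles → XI K (.role S w w') →
      XI K (.unary .top w')
  | refl {w f} : XI K f → occursF w f → XI K (.eq w w)
  | symm {w w'} : XI K (.eq w w') → XI K (.eq w' w)
  | trans {w1 w2 w3} : XI K (.eq w1 w2) → XI K (.eq w2 w3) → XI K (.eq w1 w3)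
  | repU {B w w'} : XI K (.unary B w) → XI K (.eq w w') → XI K (.unary B w')
  | repR1 {S w1 w2 w'} : XI K (.role S w1 w2) → XI K (.eq w1 w') → XI K (.role S w' w2)
  | repR2 {S w1 w2 w'} : XI K (.role S w1 w2) → XI K (.eq w2 w') → XI K (.role S w1 w')
  | repF {S A w w'} : XI K (.eq w w') → XI K (.eq (XTerm.fn S A w) (XTerm.fn S A w'))

/-- The minimal Herbrand model of dat(K) (with the equality axiomatisation). -/
inductive DM (K : KB C R Ind) : Fact C R (DTerm C R Ind) → Prop where
  | abU {B a} : AFact.unary B a ∈ K.abox → DM K (.unary B (.ind a))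
  | abR {S a b} : AFact.role S a b ∈ K.abox → DM K (.role S (.ind a) (.ind b))
  | nom {a A} : Ax.nom a A ∈ K.tbox → DM K (.unary (ctU A) (.ind a))
  | sub {A B w} : Ax.sub A B ∈ K.tbox → DM K (.unary (ctU A) w) → DM K (.unary B w)
  | subNom {A a w} : Ax.subNom A a ∈ K.tbox → DM K (.unary (ctU A) w) →
      DM K (.eq w (.ind a))
  | conj {A1 A2 A w} : Ax.conj A1 A2 A ∈ K.tbox → DM K (.unary (ctU A1) w) →
      DM K (.unary (ctU A2) w) → DM K (.unary (ctU A) w)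
  | exSub {S A1 A w w'} : Ax.exSub S A1 A ∈ K.tbox → DM K (.role S w w') →
      DM K (.unary (ctU A1) w') → DM K (.unary (ctU A) w)
  | subEx1 {A1 S A w} : Ax.subEx A1 S A ∈ K.tbox → DM K (.unary (ctU A1) w) →
      DM K (.role S w (.aux S A))
  | subEx2 {A1 S A w} : Ax.subEx A1 S A ∈ K.tbox → DM K (.unary (ctU A1) w) →
      DM K (.unary (ctU A) (.aux S A))
  | roleSub {S S' w w'} : Ax.roleSub S S' ∈ K.tbox → DM K (.role S w w') →
      DM K (.role S' w w')
  | range {S A w w'} : Ax.range S A ∈ K.tbox → DM K (.role S w w') →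
      DM K (.unary (ctU A) w')
  | topU {A w} : A ∈ K.tbox.flatMap Ax.concepts → DM K (.unary (.conc A) w) →
      DM K (.unary .top w)
  | topR1 {S w w'} : S ∈ K.tbox.flatMap Ax.roles → DM K (.role S w w') →
      DM K (.unary .top w)
  | topR2 {S w w'} : S ∈ K.tbox.flatMap Ax.roles → DM K (.role S w w') →
      DM K (.unary .top w')
  | refl {w f} : DM K f → occursF w f → DM K (.eq w w)
  | symm {w w'} : DM K (.eq w w') → DM K (.eq w' w)
  | trans {w1 w2 w3} : DM K (.eq w1 w2) → DM K (.eq w2 w3) → DM K (.eq w1 w3)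
  | repU {B w w'} : DM K (.unary B w) → DM K (.eq w w') → DM K (.unary B w')
  | repR1 {S w1 w2 w'} : DM K (.role S w1 w2) → DM K (.eq w1 w') → DM K (.role S w' w2)
  | repR2 {S w1 w2 w'} : DM K (.role S w1 w2) → DM K (.eq w2 w') → DM K (.role S w1 w')

/-- Terms of a conjunctive query: variables and individuals (constants). -/
inductive QTerm (V Ind : Type) where
  | var : V → QTerm V Ind
  | const : Ind → QTerm V Ind

/-- Function-free atoms of a conjunctive query. -/
inductive QAtom (C R V Ind : Type) where
  | unary : UPred C → QTerm V Ind → QAtom C R V Ind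
  | role : R → QTerm V Ind → QTerm V Ind → QAtom C R V Ind

/-- A conjunctive query q = ∃y.ψ(x,y): a set of atoms together with the
    predicate selecting the answer variables x. -/
structure CQ (C R V Ind : Type) where
  answers : V → Prop
  atoms : List (QAtom C R V Ind)

/-- Extension of a substitution on variables to query terms. -/
def QTerm.evalT {T : Type} (ι : Ind → T) (σ : V → T) : QTerm V Ind → T
  | .var v => σ v
  | .const a => ι a

/-- Application of a substitution to a query atom. -/
def QAtom.applyA {T : Type} (ι : Ind → T) (σ : V → T) : QAtom C R V Ind → Fact C R T
  | .unary B t => .unary B (t.evalT ι σ)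
  | .role S s t => .role S (s.evalT ι σ) (t.evalT ι σ)

/-- terms(q). -/
def CQ.terms (q : CQ C R V Ind) : List (QTerm V Ind) :=
  q.atoms.flatMap fun a => match a with
    | .unary _ t => [t]
    | .role _ s t => [s, t]

/-- Ξ(K) ⊨ σ(q): every atom of q is mapped by σ into the minimal Herbrand
    model of Ξ(K). -/
def holdsX (K : KB C R Ind) (q : CQ C R V Ind) (σ : V → XTerm C R Ind) : Prop :=
  ∀ a ∈ q.atoms, XI K (a.applyA XTerm.ind σ)

/-- dat(K) ⊨ τ(q). -/
def holdsD (K : KB C R Ind) (q : CQ C R V Ind) (τ : V → DTerm C R Ind) : Prop :=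
  ∀ a ∈ q.atoms, DM K (a.applyA DTerm.ind τ)

/-- aux(dat(K)): the individuals u of dat(K) such that dat(K) ⊨ u ≈ c for no
    named individual c. -/
def auxDat (K : KB C R Ind) (u : DTerm C R Ind) : Prop :=
  ∀ a : Ind, ¬ DM K (.eq u (.ind a))

/-- Extension of τ to the query terms (over dat(K)-terms). -/
def evalD (τ : V → DTerm C R Ind) : QTerm V Ind → DTerm C R Ind :=
  QTerm.evalT DTerm.ind τ

/-- Extension of π* to the query terms (over Ξ(K)-terms). -/
def evalX (σ : V → XTerm C R Ind) : QTerm V Ind → XTerm C R Ind :=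
  QTerm.evalT XTerm.ind σ

/-- The relation ∼ on terms(q) for q, τ and dat(K): the smallest reflexive,
    symmetric and transitive relation closed under the fork rule. -/
inductive Sim (K : KB C R Ind) (q : CQ C R V Ind) (τ : V → DTerm C R Ind) :
    QTerm V Ind → QTerm V Ind → Prop where
  | refl {t} : t ∈ q.terms → Sim K q τ t t
  | symm {s t} : Sim K q τ s t → Sim K q τ t s
  | trans {s t u} : Sim K q τ s t → Sim K q τ t u → Sim K q τ s u
  | fork {s s' t t' Rr P} : Sim K q τ s' t' → QAtom.role Rr s s' ∈ q.atoms →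
      QAtom.role P t t' ∈ q.atoms → auxDat K (evalD τ s') → Sim K q τ s t

/-- The ∼-class of `t` is a vertex of G_aux, i.e. it contains a term mapped by
    τ to a 'true' auxiliary individual. -/
def isAuxVertex (K : KB C R Ind) (q : CQ C R V Ind) (τ : V → DTerm C R Ind)
    (t : QTerm V Ind) : Prop :=
  ∃ t' ∈ q.terms, Sim K q τ t t' ∧ auxDat K (evalD τ t')

/-- The edge relation of G_aux, expressed on representatives modulo ∼:
    an edge from the class of u to the class of v for each atom R(s,t) of q
    with u ∼ s, v ∼ t and both classes vertices of G_aux. -/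
def auxEdge (K : KB C R Ind) (q : CQ C R V Ind) (τ : V → DTerm C R Ind)
    (u v : QTerm V Ind) : Prop :=
  ∃ (S : R) (s t : QTerm V Ind), QAtom.role S s t ∈ q.atoms ∧
    Sim K q τ u s ∧ Sim K q τ v t ∧ isAuxVertex K q τ s ∧ isAuxVertex K q τ t

/-- q is aux-cyclic w.r.t. τ and dat(K): G_aux contains a cycle. -/
def auxCyclic (K : KB C R Ind) (q : CQ C R V Ind) (τ : V → DTerm C R Ind) : Prop :=
  ∃ t, Relation.TransGen (auxEdge K q τ) t t

/-- isSpurious(q, dat(K), τ) = true. -/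
def Spurious (K : KB C R Ind) (q : CQ C R V Ind) (τ : V → DTerm C R Ind) : Prop :=
  (∃ v, q.answers v ∧ ∀ a : Ind, τ v ≠ .ind a) ∨
  (∃ s t, Sim K q τ s t ∧ ¬ DM K (.eq (evalD τ s) (evalD τ t))) ∨
  auxCyclic K q τ

open Classical in
/-- depth(w, I): 0 for terms outside aux(I), and 1 + depth of the argument for
    functional terms in aux(I). -/
noncomputable def depth (K : KB C R Ind) : XTerm C R Ind → ℕ
  | .ind _ => 0
  | .fn S A w => if auxT (XI K) XTerm.ind (.fn S A w) then 1 + depth K w else 0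


/-- A derivable equality relates terms equal to a named individual, identical terms, or functional
terms with the same function symbol and equal arguments. -/
theorem XI.eq_inversion {K : KB C R Ind} {s t : XTerm C R Ind} (h : XI K (.eq s t)) :
    (∃ a, XI K (.eq s (.ind a))) ∨ s = t ∨
      ∃ T A u v, s = .fn T A u ∧ t = .fn T A v ∧ XI K (.eq u v) := by
  generalize hf : Fact.eq s t = f at h
  induction h generalizing s t with
  | subNom hK hw _ => cases hf; exact .inl ⟨_, .subNom hK hw⟩
  | refl _ _ _ => cases hf; exact .inr (.inl rfl)
  | symm h ih =>
    cases hf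
    rcases ih rfl with ⟨a, ha⟩ | rfl | ⟨T, A, u, v, rfl, rfl, huv⟩
    · exact .inl ⟨a, .trans (.symm h) ha⟩
    · exact .inr (.inl rfl)
    · exact .inr (.inr ⟨T, A, v, u, rfl, rfl, .symm huv⟩)
  | trans h₁ _ ih₁ ih₂ =>
    cases hf
    rcases ih₁ rfl with ⟨a, ha⟩ | rfl | ⟨T, A, u, v, rfl, rfl, huv⟩
    · exact .inl ⟨a, ha⟩
    · exact ih₂ rfl
    · rcases ih₂ rfl with ⟨a, ha⟩ | rfl | ⟨_, _, _, w, hv, rfl, hvw⟩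
      · exact .inl ⟨a, .trans h₁ ha⟩
      · exact .inr (.inr ⟨T, A, u, v, rfl, rfl, huv⟩)
      · cases hv
        exact .inr (.inr ⟨T, A, u, w, rfl, rfl, .trans huv hvw⟩)
  | repF h _ => cases hf; exact .inr (.inr ⟨_, _, _, _, rfl, rfl, h⟩)
  | _ => cases hf

/-- The target of a derivable role fact equals a named individual or is a functional term whose
argument equals the source. -/
theorem XI.role_inversion {K : KB C R Ind} {S : R} {w w' : XTerm C R Ind}
    (h : XI K (.role S w w')) :
    (∃ a, XI K (.eq w' (.ind a))) ∨ ∃ T A u, w' = .fn T A u ∧ XI K (.eq w u) := by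
  generalize hf : Fact.role S w w' = f at h
  induction h generalizing S w w' with
  | abR hK => cases hf; exact .inl ⟨_, .refl (.abR hK) (.inr rfl)⟩
  | subEx1 _ hw _ => cases hf; exact .inr ⟨_, _, _, rfl, .refl hw rfl⟩
  | roleSub _ _ ih => cases hf; exact ih rfl
  | repR1 _ he ih _ =>
    cases hf
    rcases ih rfl with hn | ⟨T, A, u, rfl, hu⟩
    · exact .inl hn
    · exact .inr ⟨T, A, u, rfl, .trans (.symm he) hu⟩
  | repR2 _ he ih _ =>
    cases hf
    rcases ih rfl with ⟨a, ha⟩ | ⟨T, A, u, rfl, hu⟩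
    · exact .inl ⟨a, .trans (.symm he) ha⟩
    · rcases he.eq_inversion with ⟨a, ha⟩ | rfl | ⟨_, _, _, v, hv, rfl, huv⟩
      · exact .inl ⟨a, .trans (.symm he) ha⟩
      · exact .inr ⟨T, A, u, rfl, hu⟩
      · cases hv
        exact .inr ⟨T, A, v, rfl, .trans hu huv⟩
  | _ => cases hf

/-- Property P1: two role edges into ≈-equal 'true' auxiliary functional terms
    with the same function symbol have ≈-equal sources. -/
theorem fork_sources_equal (K : KB C R Ind) (w1' w1 w2' w2 : XTerm C R Ind)
    (S1 S2 T : R) (A : CT C)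
    (h1 : XI K (.role S1 w1' (.fn T A w1)))
    (h2 : XI K (.role S2 w2' (.fn T A w2)))
    (h3 : XI K (.eq (.fn T A w1) (.fn T A w2)))
    (h4 : auxT (XI K) XTerm.ind (.fn T A w2)) :
    XI K (.eq w1' w2') := by
  obtain ⟨-, hn⟩ := h4
  rcases h1.role_inversion with ⟨a, ha⟩ | ⟨_, _, _, e₁, hw₁⟩
  · exact (hn a (.trans (.symm h3) ha)).elim
  rcases h2.role_inversion with ⟨a, ha⟩ | ⟨_, _, _, e₂, hw₂⟩
  · exact (hn a ha).elim
  cases e₁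
  cases e₂
  rcases h3.eq_inversion with ⟨a, ha⟩ | e | ⟨_, _, _, _, e, e', huv⟩
  · exact (hn a (.trans (.symm h3) ha)).elim
  · cases e
    exact .trans hw₁ (.symm hw₂)
  · cases e
    cases e'
    exact .trans hw₁ (.trans huv (.symm hw₂))

end ELHO
end

section
/- Let I be the minimal Herbrand model of Ξ(K). For all terms w1 and w2: if w1≈w2∈I, then depth(w1,I)=depth(w2,I). -/
namespace ELHO

variable {C R V Ind : Type}

theorem NI_of_eq {K : KB C R Ind} {w w' : XTerm C R Ind} (h : XI K (.eq w w'))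
    (hw : NI (XI K) w) : NI (XI K) w' := by
  obtain ⟨f, hf, hocc⟩ := hw
  cases f with
  | unary B s =>
    obtain rfl : s = w := hocc
    exact ⟨_, hf.repU h, rfl⟩
  | role S s s' =>
    rcases hocc with rfl | rfl
    · exact ⟨_, hf.repR1 h, Or.inl rfl⟩
    · exact ⟨_, hf.repR2 h, Or.inr rfl⟩
  | eq s s' => exact hocc.elim

theorem auxT_of_eq {K : KB C R Ind} {w w' : XTerm C R Ind} (h : XI K (.eq w w'))
    (hw : auxT (XI K) XTerm.ind w) : auxT (XI K) XTerm.ind w' :=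
  ⟨NI_of_eq h hw.1, fun a ha => hw.2 a (h.trans ha)⟩

theorem depth_eq_zero_of_eq_ind {K : KB C R Ind} {w : XTerm C R Ind} {a : Ind}
    (h : XI K (.eq w (.ind a))) : depth K w = 0 := by
  cases w with
  | ind b => rfl
  | fn S A v => exact if_neg fun haux => haux.2 a h

theorem depth_fn_congr {K : KB C R Ind} {S : R} {A : CT C} {w w' : XTerm C R Ind}
    (h : XI K (.eq w w')) (hd : depth K w = depth K w') :
    depth K (.fn S A w) = depth K (.fn S A w') := by
  have hf : XI K (.eq (XTerm.fn S A w) (XTerm.fn S A w')) := h.repF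
  have haux : auxT (XI K) XTerm.ind (XTerm.fn S A w) ↔
      auxT (XI K) XTerm.ind (XTerm.fn S A w') :=
    ⟨auxT_of_eq hf, auxT_of_eq hf.symm⟩
  unfold depth
  rw [hd]
  split_ifs <;> tauto

/-- Property P2: ≈-equal terms of the minimal Herbrand model I of Ξ(K) have
    the same depth. -/
theorem eq_same_depth (K : KB C R Ind) (w1 w2 : XTerm C R Ind)
    (h : XI K (.eq w1 w2)) :
    depth K w1 = depth K w2 := by
  generalize hf : Fact.eq w1 w2 = f at h
  induction h generalizing w1 w2 with
  | subNom hax hw =>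
    obtain ⟨rfl, rfl⟩ := Fact.eq.inj hf
    exact depth_eq_zero_of_eq_ind (.subNom hax hw)
  | refl =>
    obtain ⟨rfl, rfl⟩ := Fact.eq.inj hf
    rfl
  | symm _ ih =>
    obtain ⟨rfl, rfl⟩ := Fact.eq.inj hf
    exact (ih _ _ rfl).symm
  | trans _ _ ih₁ ih₂ =>
    obtain ⟨rfl, rfl⟩ := Fact.eq.inj hf
    exact (ih₁ _ _ rfl).trans (ih₂ _ _ rfl)
  | repF h ih =>
    obtain ⟨rfl, rfl⟩ := Fact.eq.inj hf
    exact depth_fn_congr h (ih _ _ rfl)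
  | _ => cases hf

end ELHO
end

section
/- Let I be the minimal Herbrand model of Ξ(K). For all terms w1' and w1, every role R, every role T, and every A among the atomic concepts and ⊤: if R(w1',f_{T,A}(w1))∈I and f_{T,A}(w1)∈aux(I), then depth(f_{T,A}(w1),I)=1+depth(w1',I). -/
namespace ELHO

variable {C R V Ind : Type}

/-- `t` is ≈-equal in I to some named individual. -/
def EqNamed (K : KB C R Ind) (t : XTerm C R Ind) : Prop :=
  ∃ a : Ind, XI K (.eq t (.ind a))

theorem EqNamed.congr {K : KB C R Ind} {t t' : XTerm C R Ind} (h : XI K (.eq t t'))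
    (ht : EqNamed K t) : EqNamed K t' := by
  obtain ⟨a, ha⟩ := ht
  exact ⟨a, h.symm.trans ha⟩

/-- How ≈-facts and role facts of I arise: terms that are ≈-equal are identical, or
    both ≈-equal to named individuals, or have the same outermost function symbol and
    ≈-equal arguments; a role successor that is not ≈-equal to a named individual is a
    functional term whose argument is ≈-equal to the predecessor. -/
def FactShape (K : KB C R Ind) : Fact C R (XTerm C R Ind) → Prop
  | .unary _ _ => True
  | .role _ w u => EqNamed K u ∨ ∃ T A v, u = .fn T A v ∧ XI K (.eq w v)
  | .eq t t' => t = t' ∨ (EqNamed K t ∧ EqNamed K t') ∨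
      ∃ T A v v', t = .fn T A v ∧ t' = .fn T A v' ∧ XI K (.eq v v')

theorem XI.factShape {K : KB C R Ind} {f : Fact C R (XTerm C R Ind)} (h : XI K f) :
    FactShape K f := by
  induction h with
  | abU | nom | sub | conj | exSub | subEx2 | range | topU | topR1 | topR2 | repU =>
    exact trivial
  | abR h =>
    exact .inl ⟨_, (XI.abR h).refl (.inr rfl)⟩
  | subNom h hu =>
    have e := XI.subNom h hu
    exact .inr (.inl ⟨⟨_, e⟩, ⟨_, e.refl (.inr rfl)⟩⟩)
  | subEx1 h hu =>
    exact .inr ⟨_, _, _, rfl, hu.refl rfl⟩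
  | roleSub _ _ ih => exact ih
  | refl => exact .inl rfl
  | symm _ ih =>
    rcases ih with rfl | ⟨h1, h2⟩ | ⟨T, A, v, v', rfl, rfl, e⟩
    · exact .inl rfl
    · exact .inr (.inl ⟨h2, h1⟩)
    · exact .inr (.inr ⟨T, A, v', v, rfl, rfl, e.symm⟩)
  | trans e1 e2 ih1 ih2 =>
    rcases ih1 with rfl | ⟨h1, h2⟩ | ⟨T, A, v, v', rfl, rfl, e⟩
    · exact ih2
    · exact .inr (.inl ⟨h1, h2.congr e2⟩)
    · rcases ih2 with rfl | ⟨h1, h2⟩ | ⟨T', A', u, u', hu, rfl, e'⟩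
      · exact .inr (.inr ⟨T, A, v, v', rfl, rfl, e⟩)
      · exact .inr (.inl ⟨h1.congr e1.symm, h2⟩)
      · cases hu
        exact .inr (.inr ⟨T, A, v, u', rfl, rfl, e.trans e'⟩)
  | repR1 _ e ih _ =>
    rcases ih with h | ⟨T, A, v, rfl, e'⟩
    · exact .inl h
    · exact .inr ⟨T, A, v, rfl, e.symm.trans e'⟩
  | repR2 _ e ih1 ih2 =>
    rcases ih1 with h | ⟨T, A, v, rfl, e1⟩
    · exact .inl (h.congr e)
    · rcases ih2 with rfl | ⟨-, h⟩ | ⟨T', A', u, u', hu, rfl, e'⟩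
      · exact .inr ⟨T, A, v, rfl, e1⟩
      · exact .inl h
      · cases hu
        exact .inr ⟨T, A, u', rfl, e1.trans e'⟩
  | repF e => exact .inr (.inr ⟨_, _, _, _, rfl, rfl, e⟩)

theorem NI.congr {K : KB C R Ind} {t t' : XTerm C R Ind} (e : XI K (.eq t t'))
    (h : NI (XI K) t) : NI (XI K) t' := by
  obtain ⟨f, hf, ho⟩ := h
  cases f with
  | unary B s =>
    cases ho
    exact ⟨_, hf.repU e, rfl⟩
  | role S s s' =>
    rcases ho with rfl | rfl
    · exact ⟨_, hf.repR1 e, .inl rfl⟩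
    · exact ⟨_, hf.repR2 e, .inr rfl⟩
  | eq s s' => exact ho.elim

theorem auxT_congr {K : KB C R Ind} {t t' : XTerm C R Ind} (e : XI K (.eq t t')) :
    auxT (XI K) XTerm.ind t ↔ auxT (XI K) XTerm.ind t' :=
  ⟨fun h => ⟨h.1.congr e, fun a ha => h.2 a (e.trans ha)⟩,
    fun h => ⟨h.1.congr e.symm, fun a ha => h.2 a (e.symm.trans ha)⟩⟩

theorem EqNamed.depth_eq_zero {K : KB C R Ind} {t : XTerm C R Ind} (h : EqNamed K t) :
    depth K t = 0 := by
  obtain ⟨a, ha⟩ := h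
  cases t with
  | ind => rfl
  | fn T A v => exact if_neg fun hx => hx.2 a ha

theorem depth_congr {K : KB C R Ind} {t t' : XTerm C R Ind} (e : XI K (.eq t t')) :
    depth K t = depth K t' := by
  induction t generalizing t' with
  | ind a =>
    have h : EqNamed K t' := ⟨a, e.symm⟩
    rw [h.depth_eq_zero, depth]
  | fn T A v ih =>
    rcases e.factShape with rfl | ⟨h1, h2⟩ | ⟨T', A', u, u', hu, rfl, e'⟩
    · rfl
    · rw [h1.depth_eq_zero, h2.depth_eq_zero]
    · cases hu
      rw [depth, depth, ih e']
      congr 1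
      exact propext (auxT_congr e)

/-- Property P3: a role edge into a 'true' auxiliary functional term increases
    the depth by exactly one. -/
theorem depth_step (K : KB C R Ind) (w1' w1 : XTerm C R Ind)
    (S T : R) (A : CT C)
    (h1 : XI K (.role S w1' (.fn T A w1)))
    (h2 : auxT (XI K) XTerm.ind (.fn T A w1)) :
    depth K (.fn T A w1) = 1 + depth K w1' := by
  rcases h1.factShape with ⟨a, ha⟩ | ⟨T', A', v, hv, e⟩
  · exact absurd ha (h2.2 a)
  · cases hv
    rw [depth_congr e, depth, if_pos h2]

end ELHO
end

section
/- Let I and D be the minimal Herbrand models of Ξ(K) and dat(K). For every term w∈N_I(I): δ(w)∈aux(D) if and only if w∈aux(I). In particular, w is ≈-equal in I to some named individual exactly when δ(w) is ≈-equal in D to some named individual. -/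
namespace ELHO

variable {C R V Ind : Type}

/-- The image of an `XI`-fact under `δ`; equalities may collapse to syntactic identity. -/
def deltaFact (K : KB C R Ind) : Fact C R (XTerm C R Ind) → Prop
  | .unary B w => DM K (.unary B (δ w))
  | .role S w w' => DM K (.role S (δ w) (δ w'))
  | .eq w w' => δ w = δ w' ∨ DM K (.eq (δ w) (δ w'))

theorem XI.deltaFact {K : KB C R Ind} {f : Fact C R (XTerm C R Ind)} (h : XI K f) :
    deltaFact K f := by
  induction h with
  | abU h => exact .abU h
  | abR h => exact .abR h
  | nom h => exact .nom h
  | sub h _ ih => exact .sub h ih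
  | subNom h _ ih => exact .inr (.subNom h ih)
  | conj h _ _ ih ih' => exact .conj h ih ih'
  | exSub h _ _ ih ih' => exact .exSub h ih ih'
  | subEx1 h _ ih => exact .subEx1 h ih
  | subEx2 h _ ih => exact .subEx2 h ih
  | roleSub h _ ih => exact .roleSub h ih
  | range h _ ih => exact .range h ih
  | topU h _ ih => exact .topU h ih
  | topR1 h _ ih => exact .topR1 h ih
  | topR2 h _ ih => exact .topR2 h ih
  | refl _ _ _ => exact .inl rfl
  | symm _ ih => exact ih.imp Eq.symm .symm
  | trans _ _ ih ih' =>
    rcases ih with e | e <;> rcases ih' with e' | e'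
    · exact .inl (e.trans e')
    · exact .inr (e ▸ e')
    · exact .inr (e' ▸ e)
    · exact .inr (.trans e e')
  | repU _ _ ih ih' =>
    rcases ih' with e | e
    · simpa only [ELHO.deltaFact, e] using ih
    · exact .repU ih e
  | repR1 _ _ ih ih' =>
    rcases ih' with e | e
    · simpa only [ELHO.deltaFact, e] using ih
    · exact .repR1 ih e
  | repR2 _ _ ih ih' =>
    rcases ih' with e | e
    · simpa only [ELHO.deltaFact, e] using ih
    · exact .repR2 ih e
  | repF _ _ => exact .inl rfl

theorem NI.delta {K : KB C R Ind} {w : XTerm C R Ind} (h : NI (XI K) w) : NI (DM K) (δ w) := by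
  obtain ⟨f, hf, ho⟩ := h
  cases f with
  | unary B s => exact ⟨_, hf.deltaFact, congrArg δ ho⟩
  | role S s t => exact ⟨_, hf.deltaFact, ho.imp (congrArg δ) (congrArg δ)⟩
  | eq s t => exact ho.elim

theorem XI.refl_of_NI {K : KB C R Ind} {w : XTerm C R Ind} (h : NI (XI K) w) :
    XI K (.eq w w) := by
  obtain ⟨f, hf, ho⟩ := h
  cases f with
  | unary B s => exact .refl hf ho
  | role S s t => exact .refl hf ho
  | eq s t => exact ho.elim

theorem DM.refl_of_NI {K : KB C R Ind} {w : DTerm C R Ind} (h : NI (DM K) w) :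
    DM K (.eq w w) := by
  obtain ⟨f, hf, ho⟩ := h
  cases f with
  | unary B s => exact .refl hf ho
  | role S s t => exact .refl hf ho
  | eq s t => exact ho.elim

/-- A functional term `f_{S,A}(v)` is witnessed if it satisfies `A` and has an `S`-predecessor;
    named individuals are always witnessed. -/
def Witnessed (K : KB C R Ind) : XTerm C R Ind → Prop
  | .ind _ => True
  | .fn S A v => XI K (.unary (ctU A) (.fn S A v)) ∧ ∃ w, XI K (.role S w (.fn S A v))

def WitnessedFact (K : KB C R Ind) : Fact C R (XTerm C R Ind) → Prop
  | .unary _ w => Witnessed K w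
  | .role _ w w' => Witnessed K w ∧ Witnessed K w'
  | .eq w w' => Witnessed K w ↔ Witnessed K w'

theorem XI.witnessedFact {K : KB C R Ind} {f : Fact C R (XTerm C R Ind)} (h : XI K f) :
    WitnessedFact K f := by
  induction h with
  | abU _ => trivial
  | abR _ => exact ⟨trivial, trivial⟩
  | nom _ => trivial
  | sub _ _ ih => exact ih
  | subNom _ _ ih => exact iff_of_true ih trivial
  | conj _ _ _ ih _ => exact ih
  | exSub _ _ _ ih _ => exact ih.1
  | subEx1 h hw ih => exact ⟨ih, .subEx2 h hw, _, .subEx1 h hw⟩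
  | subEx2 h hw _ => exact ⟨.subEx2 h hw, _, .subEx1 h hw⟩
  | roleSub _ _ ih => exact ih
  | range _ _ ih => exact ih.2
  | topU _ _ ih => exact ih
  | topR1 _ _ ih => exact ih.1
  | topR2 _ _ ih => exact ih.2
  | refl _ _ _ => exact Iff.rfl
  | symm _ ih => exact ih.symm
  | trans _ _ ih ih' => exact ih.trans ih'
  | repU _ _ ih ih' => exact ih'.1 ih
  | repR1 _ _ ih ih' => exact ⟨ih'.1 ih.1, ih.2⟩
  | repR2 _ _ ih ih' => exact ⟨ih.1, ih'.1 ih.2⟩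
  | repF h _ =>
    exact ⟨fun ⟨hA, w, hw⟩ => ⟨.repU hA (.repF h), w, .repR2 hw (.repF h)⟩,
      fun ⟨hA, w, hw⟩ => ⟨.repU hA (.repF h.symm), w, .repR2 hw (.repF h.symm)⟩⟩

theorem NI.witnessed {K : KB C R Ind} {w : XTerm C R Ind} (h : NI (XI K) w) :
    Witnessed K w := by
  obtain ⟨f, hf, ho⟩ := h
  have hw := hf.witnessedFact
  cases f with
  | unary B s => cases ho; exact hw
  | role S s t => rcases ho with rfl | rfl; exacts [hw.1, hw.2]
  | eq s t => exact ho.elim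

theorem NI.of_unary {T : Type} {H : Fact C R T → Prop} {B : UPred C} {w : T}
    (h : H (.unary B w)) : NI H w := ⟨_, h, rfl⟩

theorem NI.of_role_left {T : Type} {H : Fact C R T → Prop} {S : R} {w w' : T}
    (h : H (.role S w w')) : NI H w := ⟨_, h, .inl rfl⟩

theorem NI.of_role_right {T : Type} {H : Fact C R T → Prop} {S : R} {w w' : T}
    (h : H (.role S w w')) : NI H w' := ⟨_, h, .inr rfl⟩

/-- The terms of `N_I(I)` that `δ` maps to `u`. -/
def Fib (K : KB C R Ind) (u : DTerm C R Ind) (w : XTerm C R Ind) : Prop :=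
  NI (XI K) w ∧ δ w = u

theorem Fib.eq_ind {K : KB C R Ind} {a : Ind} {w : XTerm C R Ind} (h : Fib K (.ind a) w) :
    w = .ind a := by
  obtain ⟨-, h⟩ := h
  cases w with
  | ind b => cases h; rfl
  | fn S A v => cases h

theorem Fib.witness {K : KB C R Ind} {S : R} {A : CT C} {w : XTerm C R Ind}
    (h : Fib K (.aux S A) w) : XI K (.unary (ctU A) w) ∧ ∃ w', XI K (.role S w' w) := by
  obtain ⟨hN, h⟩ := h
  cases w with
  | ind b => cases h
  | fn S' A' v => cases h; exact hN.witnessed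

/-- What a `DM`-fact says about the fibres of `δ` in the model of `Ξ(K)`. -/
def Lifted (K : KB C R Ind) : Fact C R (DTerm C R Ind) → Prop
  | .unary B u => (∃ w, Fib K u w) ∧ ∀ w, Fib K u w → XI K (.unary B w)
  | .role S u v => (∃ w, Fib K u w) ∧
      (∀ w, Fib K u w → ∃ w', Fib K v w' ∧ XI K (.role S w w')) ∧
      ∀ w', Fib K v w' → ∃ w, XI K (.role S w w')
  | .eq u v => u = v ∨ (∃ w, Fib K u w) ∧ (∃ w, Fib K v w) ∧
      ∃ a : Ind, (∀ w, Fib K u w → XI K (.eq w (.ind a))) ∧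
        ∀ w, Fib K v w → XI K (.eq w (.ind a))

theorem DM.lifted {K : KB C R Ind} {f : Fact C R (DTerm C R Ind)} (h : DM K f) :
    Lifted K f := by
  induction h with
  | abU h =>
    have h' := XI.abU h
    exact ⟨⟨_, .of_unary h', rfl⟩, fun w hw => by cases hw.eq_ind; exact h'⟩
  | abR h =>
    have h' := XI.abR h
    exact ⟨⟨_, .of_role_left h', rfl⟩,
      fun w hw => by cases hw.eq_ind; exact ⟨_, ⟨.of_role_right h', rfl⟩, h'⟩,
      fun w hw => by cases hw.eq_ind; exact ⟨_, h'⟩⟩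
  | nom h =>
    have h' := XI.nom h
    exact ⟨⟨_, .of_unary h', rfl⟩, fun w hw => by cases hw.eq_ind; exact h'⟩
  | sub h _ ih => exact ⟨ih.1, fun w hw => .sub h (ih.2 w hw)⟩
  | @subNom A a u h _ ih =>
    obtain ⟨⟨w, hw⟩, ih⟩ := ih
    have ha : Fib K (.ind a) (.ind a) :=
      ⟨.of_unary (.repU (ih w hw) (.subNom h (ih w hw))), rfl⟩
    exact .inr ⟨⟨w, hw⟩, ⟨_, ha⟩, a, fun w hw => .subNom h (ih w hw),
      fun w hw => by cases hw.eq_ind; exact .refl_of_NI ha.1⟩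
  | conj h _ _ ih ih' => exact ⟨ih.1, fun w hw => .conj h (ih.2 w hw) (ih'.2 w hw)⟩
  | exSub h _ _ ih ih' =>
    refine ⟨ih.1, fun w hw => ?_⟩
    obtain ⟨w', hw', hr⟩ := ih.2.1 w hw
    exact .exSub h hr (ih'.2 w' hw')
  | subEx1 h _ ih =>
    exact ⟨ih.1, fun w hw => have hr := XI.subEx1 h (ih.2 w hw)
      ⟨_, ⟨.of_role_right hr, rfl⟩, hr⟩, fun w' hw' => hw'.witness.2⟩
  | subEx2 h _ ih =>
    obtain ⟨⟨w, hw⟩, ih⟩ := ih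
    exact ⟨⟨_, .of_unary (.subEx2 h (ih w hw)), rfl⟩, fun w' hw' => hw'.witness.1⟩
  | roleSub h _ ih =>
    exact ⟨ih.1, fun w hw => (ih.2.1 w hw).imp fun _ h' => ⟨h'.1, .roleSub h h'.2⟩,
      fun w' hw' => (ih.2.2 w' hw').imp fun _ h' => .roleSub h h'⟩
  | range h _ ih =>
    obtain ⟨⟨w, hw⟩, ih, ih'⟩ := ih
    obtain ⟨w', hw', -⟩ := ih w hw
    refine ⟨⟨w', hw'⟩, fun v hv => ?_⟩
    obtain ⟨_, hr⟩ := ih' v hv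
    exact .range h hr
  | topU h _ ih => exact ⟨ih.1, fun w hw => .topU h (ih.2 w hw)⟩
  | topR1 h _ ih =>
    refine ⟨ih.1, fun w hw => ?_⟩
    obtain ⟨_, -, hr⟩ := ih.2.1 w hw
    exact .topR1 h hr
  | topR2 h _ ih =>
    obtain ⟨⟨w, hw⟩, ih, ih'⟩ := ih
    obtain ⟨w', hw', -⟩ := ih w hw
    refine ⟨⟨w', hw'⟩, fun v hv => ?_⟩
    obtain ⟨_, hr⟩ := ih' v hv
    exact .topR2 h hr
  | refl _ _ _ => exact .inl rfl
  | symm _ ih =>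
    rcases ih with e | ⟨h, h', a, ha, ha'⟩
    · exact .inl e.symm
    · exact .inr ⟨h', h, a, ha', ha⟩
  | trans _ _ ih ih' =>
    rcases ih with rfl | ⟨h₁, ⟨v, hv⟩, a, ha, ha'⟩
    · exact ih'
    rcases ih' with rfl | ⟨-, h₃, b, hb, hb'⟩
    · exact .inr ⟨h₁, ⟨v, hv⟩, a, ha, ha'⟩
    have hab := (ha' v hv).symm.trans (hb v hv)
    exact .inr ⟨h₁, h₃, b, fun w hw => (ha w hw).trans hab, hb'⟩
  | repU _ _ ih ih' =>
    rcases ih' with rfl | ⟨⟨w, hw⟩, h', a, ha, ha'⟩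
    · exact ih
    exact ⟨h', fun w' hw' => .repU (ih.2 w hw) ((ha w hw).trans (ha' w' hw').symm)⟩
  | repR1 _ _ ih ih' =>
    rcases ih' with rfl | ⟨⟨w, hw⟩, h', a, ha, ha'⟩
    · exact ih
    obtain ⟨v, hv, hr⟩ := ih.2.1 w hw
    exact ⟨h', fun w' hw' => ⟨v, hv, .repR1 hr ((ha w hw).trans (ha' w' hw').symm)⟩, ih.2.2⟩
  | repR2 _ _ ih ih' =>
    rcases ih' with rfl | ⟨⟨v, hv⟩, ⟨v', hv'⟩, a, ha, ha'⟩
    · exact ih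
    refine ⟨ih.1, fun w hw => ?_, fun x hx => ?_⟩
    · obtain ⟨y, hy, hr⟩ := ih.2.1 w hw
      exact ⟨v', hv', .repR2 hr ((ha y hy).trans (ha' v' hv').symm)⟩
    · obtain ⟨w, hr⟩ := ih.2.2 v hv
      exact ⟨w, .repR2 hr ((ha v hv).trans (ha' x hx).symm)⟩

theorem exists_eq_ind_iff (K : KB C R Ind) (w : XTerm C R Ind) (h : NI (XI K) w) :
    (∃ a : Ind, XI K (.eq w (.ind a))) ↔ ∃ a : Ind, DM K (.eq (δ w) (.ind a)) := by
  constructor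
  · rintro ⟨a, ha⟩
    rcases ha.deltaFact with e | e
    · have hr := DM.refl_of_NI h.delta
      exact ⟨a, by rwa [show δ w = .ind a from e] at hr ⊢⟩
    · exact ⟨a, e⟩
  · rintro ⟨a, ha⟩
    rcases ha.lifted with e | ⟨-, -, b, hb, -⟩
    · have hw : w = .ind a := Fib.eq_ind ⟨h, e⟩
      have hr := XI.refl_of_NI h
      exact ⟨a, by rwa [hw] at hr ⊢⟩
    · exact ⟨b, hb w ⟨h, rfl⟩⟩

/-- For every term w of N_I(I): δ(w) ∈ aux(D) iff w ∈ aux(I); in particular,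
    w is ≈-equal in I to a named individual exactly when δ(w) is ≈-equal in D
    to a named individual. -/
theorem aux_transfer (K : KB C R Ind) (w : XTerm C R Ind) (h : NI (XI K) w) :
    (auxT (DM K) DTerm.ind (δ w) ↔ auxT (XI K) XTerm.ind w)
  ∧ ((∃ a : Ind, XI K (.eq w (.ind a))) ↔
     (∃ a : Ind, DM K (.eq (δ w) (.ind a)))) := by
  have key := exists_eq_ind_iff K w h
  refine ⟨?_, key⟩
  rw [auxT, auxT, ← not_exists, ← not_exists, key]
  exact and_congr_left' (iff_of_true h.delta h)

end ELHO
end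

section
/- Let K be a satisfiable normalised ELHO knowledge base, q=∃y.ψ(x,y) a conjunctive query, π* a substitution with π*(q)⊆I, and τ=δ∘π* on terms(q). Then for all terms s,t of q with s∼t (where ∼ is computed for q, τ, and dat(K)): τ(s)≈τ(t) belongs to the minimal Herbrand model D of dat(K), and π*(s)≈π*(t) belongs to the minimal Herbrand model I of Ξ(K). -/
namespace ELHO

variable {C R V Ind : Type}

/-- The image under `δ` of a fact of Ξ(K) holds in `D`; an equality may instead become
    syntactic, since function congruence also yields equalities between terms that are
    mapped to auxiliary individuals not occurring in `D`. -/
def HoldsDelta (K : KB C R Ind) : Fact C R (XTerm C R Ind) → Prop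
  | .unary B w => DM K (.unary B (δ w))
  | .role S w w' => DM K (.role S (δ w) (δ w'))
  | .eq w w' => δ w = δ w' ∨ DM K (.eq (δ w) (δ w'))

theorem XI.holdsDelta {K : KB C R Ind} {f : Fact C R (XTerm C R Ind)} (h : XI K f) :
    HoldsDelta K f := by
  induction h with
  | abU h => exact .abU h
  | abR h => exact .abR h
  | nom h => exact .nom h
  | sub h _ ih => exact .sub h ih
  | subNom h _ ih => exact .inr (.subNom h ih)
  | conj h _ _ ih₁ ih₂ => exact .conj h ih₁ ih₂
  | exSub h _ _ ih₁ ih₂ => exact .exSub h ih₁ ih₂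
  | subEx1 h _ ih => exact .subEx1 h ih
  | subEx2 h _ ih => exact .subEx2 h ih
  | roleSub h _ ih => exact .roleSub h ih
  | range h _ ih => exact .range h ih
  | topU h _ ih => exact .topU h ih
  | topR1 h _ ih => exact .topR1 h ih
  | topR2 h _ ih => exact .topR2 h ih
  | refl => exact .inl rfl
  | symm _ ih => exact ih.imp Eq.symm .symm
  | trans _ _ ih₁ ih₂ =>
    rcases ih₁ with e | h₁
    · simpa only [HoldsDelta, e] using ih₂
    · rcases ih₂ with e | h₂
      · exact .inr (e ▸ h₁)
      · exact .inr (.trans h₁ h₂)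
  | repU _ _ ih₁ ih₂ =>
    rcases ih₂ with e | h₂
    · simpa only [HoldsDelta, e] using ih₁
    · exact .repU ih₁ h₂
  | repR1 _ _ ih₁ ih₂ =>
    rcases ih₂ with e | h₂
    · simpa only [HoldsDelta, e] using ih₁
    · exact .repR1 ih₁ h₂
  | repR2 _ _ ih₁ ih₂ =>
    rcases ih₂ with e | h₂
    · simpa only [HoldsDelta, e] using ih₁
    · exact .repR2 ih₁ h₂
  | repF => exact .inl rfl

/-- `w` is equal in `I` to a named individual. -/
def IsNamed (K : KB C R Ind) (w : XTerm C R Ind) : Prop :=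
  ∃ a, XI K (.eq w (.ind a))

theorem IsNamed.of_eq {K : KB C R Ind} {w w' : XTerm C R Ind} (hw : IsNamed K w)
    (h : XI K (.eq w w')) : IsNamed K w' :=
  let ⟨a, ha⟩ := hw
  ⟨a, .trans (.symm h) ha⟩

/-- Forest shape of `I`: up to named individuals, equality is generated by function
    congruence, and every role edge leads from a term to one of its functional successors. -/
def ForestShaped (K : KB C R Ind) : Fact C R (XTerm C R Ind) → Prop
  | .unary _ _ => True
  | .role _ w w' => IsNamed K w' ∨ ∃ S A u, w' = .fn S A u ∧ XI K (.eq u w)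
  | .eq w w' => IsNamed K w ∨ w = w' ∨
      ∃ S A u u', w = .fn S A u ∧ w' = .fn S A u' ∧ XI K (.eq u u')

theorem XI.forestShaped {K : KB C R Ind} {f : Fact C R (XTerm C R Ind)} (h : XI K f) :
    ForestShaped K f := by
  induction h with
  | abR h => exact .inl ⟨_, .refl (.abR h) (.inr rfl)⟩
  | subNom h hw => exact .inl ⟨_, .subNom h hw⟩
  | subEx1 _ hw => exact .inr ⟨_, _, _, rfl, .refl hw rfl⟩
  | roleSub _ _ ih => exact ih
  | refl => exact .inr (.inl rfl)
  | symm h ih =>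
    rcases ih with hn | rfl | ⟨S, A, u, u', rfl, rfl, hu⟩
    · exact .inl (hn.of_eq h)
    · exact .inr (.inl rfl)
    · exact .inr (.inr ⟨S, A, u', u, rfl, rfl, .symm hu⟩)
  | trans h₁ _ ih₁ ih₂ =>
    rcases ih₁ with hn | rfl | ⟨S, A, u, u', rfl, rfl, hu⟩
    · exact .inl hn
    · exact ih₂
    · rcases ih₂ with hn | rfl | ⟨S', A', v, v', e, rfl, hv⟩
      · exact .inl (hn.of_eq (.symm h₁))
      · exact .inr (.inr ⟨S, A, u, u', rfl, rfl, hu⟩)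
      · cases e
        exact .inr (.inr ⟨S, A, u, v', rfl, rfl, .trans hu hv⟩)
  | repR1 _ h ih _ =>
    exact ih.imp_right fun ⟨S, A, u, e, hu⟩ => ⟨S, A, u, e, .trans hu h⟩
  | repR2 _ h ih₁ ih₂ =>
    rcases ih₁ with hn | ⟨S, A, u, rfl, hu⟩
    · exact .inl (hn.of_eq h)
    · rcases ih₂ with hn | rfl | ⟨S', A', v, v', e, rfl, hv⟩
      · exact .inl (hn.of_eq h)
      · exact .inr ⟨S, A, u, rfl, hu⟩
      · cases e
        exact .inr ⟨S, A, v', rfl, .trans (.symm hv) hu⟩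
  | repF h => exact .inr (.inr ⟨_, _, _, _, rfl, rfl, h⟩)
  | _ => trivial

/-- Role edges of `I` into equal terms that are not named have equal sources. -/
theorem XI.eq_of_role_of_role {K : KB C R Ind} {S P : R} {w w' v v' : XTerm C R Ind}
    (hw : XI K (.role S w w')) (hv : XI K (.role P v v')) (h : XI K (.eq w' v'))
    (hn : ¬ IsNamed K w') : XI K (.eq w v) := by
  obtain hn' | ⟨_, _, u, rfl, hu⟩ := hw.forestShaped
  · exact absurd hn' hn
  obtain hn' | ⟨_, _, u', rfl, hu'⟩ := hv.forestShaped
  · exact absurd (hn'.of_eq (.symm h)) hn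
  have huu' : XI K (.eq u u') := by
    obtain hn' | e | ⟨_, _, _, _, e, e', he⟩ := h.forestShaped
    · exact absurd hn' hn
    · cases e
      exact .trans hu (.symm hu)
    · cases e
      cases e'
      exact he
  exact .trans (.symm hu) (.trans huu' hu')

theorem δ_evalX {τ : V → DTerm C R Ind} {πs : V → XTerm C R Ind}
    (hτ : ∀ v, τ v = δ (πs v)) (t : QTerm V Ind) : δ (evalX πs t) = evalD τ t := by
  cases t with
  | var v => exact (hτ v).symm
  | const a => rfl

/-- Every query term is mapped to a term occurring in both models. -/
theorem refl_of_mem_terms {K : KB C R Ind} {q : CQ C R V Ind} {πs : V → XTerm C R Ind}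
    (hmap : holdsX K q πs) {t : QTerm V Ind} (ht : t ∈ q.terms) :
    DM K (.eq (δ (evalX πs t)) (δ (evalX πs t))) ∧
      XI K (.eq (evalX πs t) (evalX πs t)) := by
  obtain ⟨a, ha, hta⟩ := List.mem_flatMap.1 ht
  have hX := hmap a ha
  have hD := hX.holdsDelta
  cases a with
  | unary B s =>
    obtain rfl := List.mem_singleton.1 hta
    exact ⟨.refl hD rfl, .refl hX rfl⟩
  | role S s s' =>
    obtain rfl | hta := List.mem_cons.1 hta
    · exact ⟨.refl hD (.inl rfl), .refl hX (.inl rfl)⟩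
    · obtain rfl := List.mem_singleton.1 hta
      exact ⟨.refl hD (.inr rfl), .refl hX (.inr rfl)⟩

/-- The constraints of ∼ are satisfied both by τ = δ ∘ π* in the minimal
    Herbrand model D of dat(K) and by π* in the minimal Herbrand model I of
    Ξ(K). -/
theorem sim_constraints_satisfied (K : KB C R Ind)
    (hsat : ¬ ∃ w : XTerm C R Ind, XI K (.unary .bot w))
    (q : CQ C R V Ind) (πs : V → XTerm C R Ind) (hmap : holdsX K q πs)
    (τ : V → DTerm C R Ind) (hτ : ∀ v, τ v = δ (πs v)) :
    ∀ s t : QTerm V Ind, Sim K q τ s t →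
      DM K (.eq (evalD τ s) (evalD τ t)) ∧
      XI K (.eq (evalX πs s) (evalX πs t)) := by
  intro s t h
  simp only [← δ_evalX hτ]
  induction h with
  | refl ht => exact refl_of_mem_terms hmap ht
  | symm _ ih => exact ⟨.symm ih.1, .symm ih.2⟩
  | trans _ _ ih₁ ih₂ => exact ⟨.trans ih₁.1 ih₂.1, .trans ih₁.2 ih₂.2⟩
  | @fork s s' t t' S P _ hs ht haux ih =>
    have hS : XI K (.role S (evalX πs s) (evalX πs s')) := hmap _ hs
    have hP : XI K (.role P (evalX πs t) (evalX πs t')) := hmap _ ht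
    have hSD : DM K (.role S (δ (evalX πs s)) (δ (evalX πs s'))) := hS.holdsDelta
    rw [← δ_evalX hτ] at haux
    have hn : ¬ IsNamed K (evalX πs s') := by
      rintro ⟨a, ha⟩
      obtain e | h := ha.holdsDelta
      · have hrefl := DM.refl hSD (.inr rfl)
        rw [e] at hrefl
        exact haux a (e ▸ hrefl)
      · exact haux a h
    have hX := hS.eq_of_role_of_role hP ih.2 hn
    refine ⟨?_, hX⟩
    obtain e | h := hX.holdsDelta
    · exact e ▸ .refl hSD (.inl rfl)
    · exact h

end ELHO
end
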